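/- Suppose $f: [0,\infty) \to [0,\infty)$ is non-decreasing with Laplace transform satisfying $\int_0^\infty f(T) e^{-\lambda T}\, dT = \frac{g(\lambda)}{\lambda(g(\lambda)-1)}$ where $g(\lambda) \to 1$ and $g'$ is continuous at the relevant point with $(g(\lambda)-1) \sim \lambda/\psi'(1)$ as $\lambda \downarrow 0$ for some constant $\psi'(1) > 0$. Then $\int_0^\infty f(T)e^{-\lambda T}dT \sim \psi'(1)/\lambda^2$ as $\lambda \downarrow 0$, and by the Tauberian theorem for monotone functions, $f(T) \sim \psi'(1)\, T$ as $T \to \infty$. -/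

import Mathlib

open MeasureTheory Real Filter

open scoped Topology

section Moments

variable {α : Type*} [MeasurableSpace α] {μ : Measure α} {w X : α → ℝ}

/-- An integrable weight times a continuous function of a `[0, 1]`-valued variable is integrable. -/
lemma integrable_mul_comp_of_mem_Icc (hw : Integrable w μ) (hX : AEStronglyMeasurable X μ)
    (hX01 : ∀ᵐ x ∂μ, X x ∈ Set.Icc (0 : ℝ) 1) {h : ℝ → ℝ} (hh : Continuous h) :
    Integrable (fun x => w x * h (X x)) μ := by
  obtain ⟨B, hB⟩ := (isCompact_Icc (a := (0 : ℝ)) (b := 1)).exists_bound_of_continuousOn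
    hh.continuousOn
  exact hw.mul_bdd (hh.comp_aestronglyMeasurable hX) (hX01.mono fun x hx => hB _ hx)

lemma abs_integral_mul_comp_sub_le (hw : Integrable w μ) (hw0 : 0 ≤ᵐ[μ] w)
    (hX : AEStronglyMeasurable X μ) (hX01 : ∀ᵐ x ∂μ, X x ∈ Set.Icc (0 : ℝ) 1) {h p : ℝ → ℝ}
    (hh : Continuous h) (hp : Continuous p) {ε : ℝ}
    (hhp : ∀ x ∈ Set.Icc (0 : ℝ) 1, |p x - h x| ≤ ε) :
    |∫ x, w x * p (X x) ∂μ - ∫ x, w x * h (X x) ∂μ| ≤ ε * ∫ x, w x ∂μ := by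
  rw [← integral_sub (integrable_mul_comp_of_mem_Icc hw hX hX01 hp)
    (integrable_mul_comp_of_mem_Icc hw hX hX01 hh), ← integral_const_mul, ← Real.norm_eq_abs]
  refine norm_integral_le_of_norm_le (hw.const_mul ε) ?_
  filter_upwards [hw0, hX01] with x h0 h1
  have h0' : 0 ≤ w x := h0
  rw [← mul_sub, norm_mul, Real.norm_of_nonneg h0', Real.norm_eq_abs, mul_comm]
  exact mul_le_mul_of_nonneg_right (hhp _ h1) h0'

/-- Method of moments on `[0, 1]`: convergence of all weighted moments implies convergence of the
weighted integrals of all continuous functions. -/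
lemma tendsto_integral_mul_comp_of_tendsto_moments {ι : Type*} {l : Filter ι}
    {W Y : ι → α → ℝ} (hw : Integrable w μ) (hw0 : 0 ≤ᵐ[μ] w)
    (hX : AEStronglyMeasurable X μ) (hX01 : ∀ᵐ x ∂μ, X x ∈ Set.Icc (0 : ℝ) 1)
    (hW : ∀ᶠ i in l, Integrable (W i) μ ∧ 0 ≤ᵐ[μ] W i ∧ AEStronglyMeasurable (Y i) μ ∧
      ∀ᵐ x ∂μ, Y i x ∈ Set.Icc (0 : ℝ) 1)
    (hmom : ∀ n : ℕ, Tendsto (fun i => ∫ x, W i x * Y i x ^ n ∂μ) l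
      (𝓝 (∫ x, w x * X x ^ n ∂μ)))
    {h : ℝ → ℝ} (hh : Continuous h) :
    Tendsto (fun i => ∫ x, W i x * h (Y i x) ∂μ) l (𝓝 (∫ x, w x * h (X x) ∂μ)) := by
  have hpoly : ∀ p : Polynomial ℝ, Tendsto (fun i => ∫ x, W i x * p.eval (Y i x) ∂μ) l
      (𝓝 (∫ x, w x * p.eval (X x) ∂μ)) := by
    intro p
    induction p using Polynomial.induction_on' with
    | add p q hp hq =>
      simp only [Polynomial.eval_add, mul_add]
      rw [integral_add (integrable_mul_comp_of_mem_Icc hw hX hX01 p.continuous)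
        (integrable_mul_comp_of_mem_Icc hw hX hX01 q.continuous)]
      refine (hp.add hq).congr' ?_
      filter_upwards [hW] with i ⟨h1, _, h3, h4⟩
      rw [integral_add (integrable_mul_comp_of_mem_Icc h1 h3 h4 p.continuous)
        (integrable_mul_comp_of_mem_Icc h1 h3 h4 q.continuous)]
    | monomial n a =>
      simp only [Polynomial.eval_monomial, mul_left_comm _ a, integral_const_mul]
      exact (hmom n).const_mul a
  have hM : 0 ≤ ∫ x, w x ∂μ := integral_nonneg_of_ae hw0
  have hmass : Tendsto (fun i => ∫ x, W i x ∂μ) l (𝓝 (∫ x, w x ∂μ)) := by simpa using hmom 0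
  set M := ∫ x, w x ∂μ
  rw [Metric.tendsto_nhds]
  intro ε hε
  set η := ε / (2 * M + 2) with hη
  have hη0 : 0 < η := by positivity
  have hηε : η * (2 * M + 2) = ε := by rw [hη]; field_simp
  obtain ⟨p, hp⟩ := exists_polynomial_near_of_continuousOn 0 1 h hh.continuousOn η hη0
  have hp' : ∀ x ∈ Set.Icc (0 : ℝ) 1, |p.eval x - h x| ≤ η := fun x hx => (hp x hx).le
  have hlim := abs_integral_mul_comp_sub_le hw hw0 hX hX01 hh p.continuous hp'
  filter_upwards [hW, hmass.eventually_lt_const (lt_add_one M),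
    (Metric.tendsto_nhds.1 (hpoly p)) η hη0] with i ⟨h1, h2, h3, h4⟩ h5 h6
  have hi := abs_integral_mul_comp_sub_le h1 h2 h3 h4 hh p.continuous hp'
  have h7 := mul_lt_mul_of_pos_left h5 hη0
  rw [Real.dist_eq] at h6 ⊢
  rw [abs_le] at hlim hi
  rw [abs_lt] at h6 ⊢
  constructor <;> linarith [hlim.1, hlim.2, hi.1, hi.2, h6.1, h6.2]

end Moments

lemma exp_neg_mul_mem_Icc {l T : ℝ} (hl : 0 < l) (hT : 0 < T) :
    Real.exp (-l * T) ∈ Set.Icc (0 : ℝ) 1 :=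
  ⟨(Real.exp_pos _).le, Real.exp_le_one_iff.2 (by nlinarith [mul_pos hl hT])⟩

lemma ae_exp_neg_mul_mem_Icc {l : ℝ} (hl : 0 < l) :
    ∀ᵐ T ∂volume.restrict (Set.Ioi (0 : ℝ)), Real.exp (-l * T) ∈ Set.Icc (0 : ℝ) 1 :=
  (ae_restrict_mem measurableSet_Ioi).mono fun _ hT => exp_neg_mul_mem_Icc hl hT

lemma aestronglyMeasurable_exp_neg_mul (l : ℝ) (μ : Measure ℝ) :
    AEStronglyMeasurable (fun T => Real.exp (-l * T)) μ :=
  (by fun_prop : Continuous fun T : ℝ => Real.exp (-l * T)).aestronglyMeasurable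

lemma integral_linear_mul_exp_neg_mul_pow (C : ℝ) (n : ℕ) :
    ∫ T in Set.Ioi (0 : ℝ), (1 : ℝ) ^ 2 * (C * T * Real.exp (-1 * T)) * Real.exp (-1 * T) ^ n =
      C / ((n : ℝ) + 1) ^ 2 := by
  have hn : (0 : ℝ) < (n : ℝ) + 1 := by positivity
  have h := Real.integral_rpow_mul_exp_neg_mul_Ioi (a := 2) two_pos hn
  have h2 : ∀ T : ℝ, (1 : ℝ) ^ 2 * (C * T * Real.exp (-1 * T)) * Real.exp (-1 * T) ^ n =
      C * (T ^ ((2 : ℝ) - 1) * Real.exp (-(((n : ℝ) + 1) * T))) := by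
    intro T
    have : (2 : ℝ) - 1 = 1 := by norm_num
    rw [this, Real.rpow_one, ← Real.exp_nat_mul,
      show -(((n : ℝ) + 1) * T) = -1 * T + n * (-1 * T) by ring, Real.exp_add]
    ring
  simp_rw [h2]
  rw [integral_const_mul, h, Real.Gamma_two, Real.rpow_two]
  field_simp

lemma integrableOn_linear_mul_exp_neg (C : ℝ) :
    IntegrableOn (fun T : ℝ => C * T * Real.exp (-1 * T)) (Set.Ioi 0) := by
  have h := (Real.GammaIntegral_convergent (s := 2) two_pos).const_mul C
  refine h.congr (ae_of_all _ fun T => ?_)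
  have : (2 : ℝ) - 1 = 1 := by norm_num
  simp only [this, Real.rpow_one, neg_one_mul]
  ring

/-- Rescaling the Laplace variable by `n + 1` gives the moments of `exp (-l * T)`. -/
lemma tendsto_laplace_moments {f : ℝ → ℝ} {C : ℝ}
    (hlaplace : Tendsto (fun l : ℝ => l ^ 2 * ∫ T in Set.Ioi (0:ℝ), f T * Real.exp (-l * T))
      (𝓝[>] 0) (𝓝 C)) (n : ℕ) :
    Tendsto (fun l : ℝ => ∫ T in Set.Ioi (0:ℝ),
      l ^ 2 * (f T * Real.exp (-l * T)) * Real.exp (-l * T) ^ n)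
      (𝓝[>] 0) (𝓝 (C / ((n : ℝ) + 1) ^ 2)) := by
  have hn : (0 : ℝ) < (n : ℝ) + 1 := by positivity
  have hscale : Tendsto (fun l : ℝ => ((n : ℝ) + 1) * l) (𝓝[>] 0) (𝓝[>] 0) := by
    refine tendsto_nhdsWithin_iff.2 ⟨?_, ?_⟩
    · have : Tendsto (fun l : ℝ => ((n : ℝ) + 1) * l) (𝓝 0) (𝓝 (((n : ℝ) + 1) * 0)) :=
        tendsto_id.const_mul _
      rw [mul_zero] at this
      exact this.mono_left nhdsWithin_le_nhds
    · filter_upwards [self_mem_nhdsWithin] with l hl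
      exact mul_pos hn hl
  refine ((hlaplace.comp hscale).div_const (((n : ℝ) + 1) ^ 2)).congr fun l => ?_
  have h2 : ∀ T : ℝ, l ^ 2 * (f T * Real.exp (-l * T)) * Real.exp (-l * T) ^ n =
      l ^ 2 * (f T * Real.exp (-(((n : ℝ) + 1) * l) * T)) := by
    intro T
    rw [← Real.exp_nat_mul, show -(((n : ℝ) + 1) * l) * T = -l * T + n * (-l * T) by ring,
      Real.exp_add]
    ring
  simp_rw [h2]
  rw [integral_const_mul, Function.comp_apply]
  field_simp

lemma eventually_integrableOn_laplace {f : ℝ → ℝ} {C : ℝ} (hC : 0 < C)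
    (hlaplace : Tendsto (fun l : ℝ => l ^ 2 * ∫ T in Set.Ioi (0:ℝ), f T * Real.exp (-l * T))
      (𝓝[>] 0) (𝓝 C)) :
    ∀ᶠ l : ℝ in 𝓝[>] 0, IntegrableOn (fun T => f T * Real.exp (-l * T)) (Set.Ioi 0) := by
  filter_upwards [hlaplace.eventually_const_lt hC] with l hl
  by_contra hint
  rw [integral_undef hint, mul_zero] at hl
  exact hl.false

/-- Averaging a monotone function against a nonnegative kernel supported in `[c, d]` gives a value
between those at the endpoints, rescaled by `l`. -/
lemma laplace_average_bounds {f h : ℝ → ℝ} {l c d : ℝ} (hl : 0 < l) (hc : 0 ≤ c) (hcd : c ≤ d)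
    (hf_mono : MonotoneOn f (Set.Ici (0 : ℝ)))
    (hint : IntegrableOn (fun T => f T * Real.exp (-l * T)) (Set.Ioi 0))
    (hh : Continuous h) (hh0 : ∀ x, 0 ≤ h x)
    (hsupp : ∀ u, u < c ∨ d < u → h (Real.exp (-1 * u)) = 0) :
    l * f (c / l) * (∫ u in Set.Ioi (0 : ℝ), Real.exp (-1 * u) * h (Real.exp (-1 * u))) ≤
      ∫ T in Set.Ioi (0 : ℝ), l ^ 2 * (f T * Real.exp (-l * T)) * h (Real.exp (-l * T)) ∧
    ∫ T in Set.Ioi (0 : ℝ), l ^ 2 * (f T * Real.exp (-l * T)) * h (Real.exp (-l * T)) ≤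
      l * f (d / l) *
        (∫ u in Set.Ioi (0 : ℝ), Real.exp (-1 * u) * h (Real.exp (-1 * u))) := by
  have hkernel : IntegrableOn (fun T => Real.exp (-l * T) * h (Real.exp (-l * T)))
      (Set.Ioi 0) :=
    integrable_mul_comp_of_mem_Icc (integrableOn_exp_mul_Ioi (by linarith) 0)
      (aestronglyMeasurable_exp_neg_mul l _) (ae_exp_neg_mul_mem_Icc hl) hh
  have hmid : IntegrableOn
      (fun T => l ^ 2 * (f T * Real.exp (-l * T)) * h (Real.exp (-l * T))) (Set.Ioi 0) :=
    integrable_mul_comp_of_mem_Icc (hint.const_mul _)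
      (aestronglyMeasurable_exp_neg_mul l _) (ae_exp_neg_mul_mem_Icc hl) hh
  have hconst : ∀ a : ℝ, l * a *
      (∫ u in Set.Ioi (0 : ℝ), Real.exp (-1 * u) * h (Real.exp (-1 * u))) =
      ∫ T in Set.Ioi (0 : ℝ), l ^ 2 * a * (Real.exp (-l * T) * h (Real.exp (-l * T))) := by
    intro a
    have := integral_comp_mul_left_Ioi
      (fun u => Real.exp (-1 * u) * h (Real.exp (-1 * u))) 0 hl
    simp only [mul_zero, smul_eq_mul, ← mul_assoc, neg_one_mul] at this
    rw [integral_const_mul]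
    simp only [neg_one_mul, this]
    field_simp
  have hcase : ∀ T, 0 < T → h (Real.exp (-l * T)) = 0 ∨ (f (c / l) ≤ f T ∧ f T ≤ f (d / l)) := by
    intro T hT
    by_cases hlt : l * T < c ∨ d < l * T
    · left
      have := hsupp _ hlt
      rwa [show -1 * (l * T) = -l * T by ring] at this
    · right
      push Not at hlt
      refine ⟨hf_mono (div_nonneg hc hl.le) hT.le ?_,
        hf_mono hT.le (div_nonneg (hc.trans hcd) hl.le) ?_⟩
      · rw [div_le_iff₀ hl]; linarith
      · rw [le_div_iff₀ hl]; linarith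
  rw [hconst, hconst]
  constructor
  · refine setIntegral_mono_on (hkernel.const_mul _) hmid measurableSet_Ioi fun T hT => ?_
    rcases hcase T hT with h0 | ⟨h1, -⟩
    · simp only [h0, mul_zero, le_refl]
    · have := mul_le_mul_of_nonneg_left h1
        (mul_nonneg (sq_nonneg l) (mul_nonneg (Real.exp_pos (-l * T)).le (hh0 (Real.exp (-l * T)))))
      linarith
  · refine setIntegral_mono_on hmid (hkernel.const_mul _) measurableSet_Ioi fun T hT => ?_
    rcases hcase T hT with h0 | ⟨-, h1⟩
    · simp only [h0, mul_zero, le_refl]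
    · have := mul_le_mul_of_nonneg_left h1
        (mul_nonneg (sq_nonneg l) (mul_nonneg (Real.exp_pos (-l * T)).le (hh0 (Real.exp (-l * T)))))
      linarith

lemma exists_laplace_kernel {c d : ℝ} (hc : 0 ≤ c) (hcd : c < d) :
    ∃ h : ℝ → ℝ, Continuous h ∧ (∀ x, 0 ≤ h x) ∧
      (∀ u, u < c ∨ d < u → h (Real.exp (-1 * u)) = 0) ∧
      0 < ∫ u in Set.Ioi (0 : ℝ), Real.exp (-1 * u) * h (Real.exp (-1 * u)) := by
  set h : ℝ → ℝ := fun x => max 0 ((x - Real.exp (-1 * d)) * (Real.exp (-1 * c) - x)) with hdef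
  have hcont : Continuous h := by fun_prop
  have hh0 : ∀ x, 0 ≤ h x := fun x => le_max_left _ _
  refine ⟨h, hcont, hh0, fun u hu => max_eq_left ?_, ?_⟩
  · have hdc : Real.exp (-1 * d) < Real.exp (-1 * c) := Real.exp_lt_exp.2 (by linarith)
    rcases hu with hu | hu
    · have : Real.exp (-1 * c) < Real.exp (-1 * u) := Real.exp_lt_exp.2 (by linarith)
      exact mul_nonpos_of_nonneg_of_nonpos (by linarith) (by linarith)
    · have : Real.exp (-1 * u) < Real.exp (-1 * d) := Real.exp_lt_exp.2 (by linarith)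
      exact mul_nonpos_of_nonpos_of_nonneg (by linarith) (by linarith)
  · rw [setIntegral_pos_iff_support_of_nonneg_ae
      (ae_of_all _ fun u => mul_nonneg (Real.exp_pos _).le (hh0 _))
      (integrable_mul_comp_of_mem_Icc (integrableOn_exp_mul_Ioi (by norm_num) 0)
        (aestronglyMeasurable_exp_neg_mul 1 _) (ae_exp_neg_mul_mem_Icc one_pos) hcont)]
    have hsub : Set.Ioo c d ⊆ (Function.support fun u =>
        Real.exp (-1 * u) * h (Real.exp (-1 * u))) ∩ Set.Ioi 0 := by
      rintro u ⟨hu1, hu2⟩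
      have h1 : Real.exp (-1 * u) < Real.exp (-1 * c) := Real.exp_lt_exp.2 (by linarith)
      have h2 : Real.exp (-1 * d) < Real.exp (-1 * u) := Real.exp_lt_exp.2 (by linarith)
      refine ⟨(mul_pos (Real.exp_pos _) (lt_max_of_lt_right ?_)).ne', hc.trans_lt hu1⟩
      exact mul_pos (by linarith) (by linarith)
    refine lt_of_lt_of_le ?_ (measure_mono hsub)
    simpa using hcd

/-- Weak form of the Tauberian theorem: comparison of `l * f (c / l)` and `l * f (d / l)` with the
linear function, for `c < d`. -/
lemma eventually_laplace_bounds {f : ℝ → ℝ} {C : ℝ} (hC : 0 < C)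
    (hf_nonneg : ∀ T, 0 ≤ T → 0 ≤ f T)
    (hf_mono : MonotoneOn f (Set.Ici (0:ℝ)))
    (hlaplace : Tendsto (fun l : ℝ => l ^ 2 * ∫ T in Set.Ioi (0:ℝ), f T * Real.exp (-l * T))
      (𝓝[>] 0) (𝓝 C)) {c d : ℝ} (hc : 0 ≤ c) (hcd : c < d) :
    (∀ b, C * d < b → ∀ᶠ l : ℝ in 𝓝[>] 0, l * f (c / l) < b) ∧
      ∀ a, a < C * c → ∀ᶠ l : ℝ in 𝓝[>] 0, a < l * f (d / l) := by
  obtain ⟨h, hh, hh0, hsupp, hK⟩ := exists_laplace_kernel hc hcd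
  have hint := eventually_integrableOn_laplace hC hlaplace
  have hlim : Tendsto (fun l : ℝ => ∫ T in Set.Ioi (0 : ℝ),
      l ^ 2 * (f T * Real.exp (-l * T)) * h (Real.exp (-l * T))) (𝓝[>] 0)
      (𝓝 (∫ T in Set.Ioi (0 : ℝ),
        (1 : ℝ) ^ 2 * (C * T * Real.exp (-1 * T)) * h (Real.exp (-1 * T)))) := by
    refine tendsto_integral_mul_comp_of_tendsto_moments
      ((integrableOn_linear_mul_exp_neg C).const_mul _) ?_
      (aestronglyMeasurable_exp_neg_mul 1 _) (ae_exp_neg_mul_mem_Icc one_pos) ?_ ?_ hh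
    · filter_upwards [ae_restrict_mem measurableSet_Ioi] with T hT
      have hT' : 0 < T := hT
      simp only [Pi.zero_apply]
      positivity
    · filter_upwards [hint, self_mem_nhdsWithin] with l hl hl0
      refine ⟨hl.const_mul _, ?_, aestronglyMeasurable_exp_neg_mul l _,
        ae_exp_neg_mul_mem_Icc hl0⟩
      filter_upwards [ae_restrict_mem measurableSet_Ioi] with T hT
      have := hf_nonneg T (le_of_lt hT)
      simp only [Pi.zero_apply]
      positivity
    · intro n
      rw [integral_linear_mul_exp_neg_mul_pow]
      exact tendsto_laplace_moments hlaplace n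
  obtain ⟨hlow, hupp⟩ := laplace_average_bounds one_pos hc hcd.le
    (fun x _ y _ hxy => mul_le_mul_of_nonneg_left hxy hC.le)
    (integrableOn_linear_mul_exp_neg C) hh hh0 hsupp
  rw [one_mul, div_one] at hlow hupp
  constructor
  · intro b hb
    filter_upwards [hlim.eventually_lt_const (hupp.trans_lt (mul_lt_mul_of_pos_right hb hK)),
      hint, self_mem_nhdsWithin] with l h1 h2 h3
    exact lt_of_mul_lt_mul_right
      ((laplace_average_bounds h3 hc hcd.le hf_mono h2 hh hh0 hsupp).1.trans_lt h1) hK.le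
  · intro a ha
    filter_upwards [hlim.eventually_const_lt ((mul_lt_mul_of_pos_right ha hK).trans_le hlow),
      hint, self_mem_nhdsWithin] with l h1 h2 h3
    exact lt_of_mul_lt_mul_right
      (h1.trans_le (laplace_average_bounds h3 hc hcd.le hf_mono h2 hh hh0 hsupp).2) hK.le

/-- Karamata Tauberian theorem application: if `f ≥ 0` is non-decreasing and
its Laplace transform satisfies `∫_0^∞ f(T) e^{-λT} dT ∼ C/λ²` as `λ ↓ 0`
for a constant `C > 0`, then `f(T) ∼ C T` as `T → ∞`. -/
theorem tauberian_linear_growth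
    (f : ℝ → ℝ) (C : ℝ) (hC : 0 < C)
    (hf_nonneg : ∀ T, 0 ≤ T → 0 ≤ f T)
    (hf_mono : MonotoneOn f (Set.Ici (0:ℝ)))
    (hlaplace : Tendsto (fun lam : ℝ =>
        lam ^ 2 * ∫ T in Set.Ioi (0:ℝ), f T * Real.exp (-lam * T))
      (nhdsWithin 0 (Set.Ioi 0)) (nhds C)) :
    Tendsto (fun T => f T / T) atTop (nhds C) := by
  have hinv : Tendsto (fun T : ℝ => T⁻¹) atTop (nhdsWithin 0 (Set.Ioi 0)) :=
    tendsto_inv_atTop_nhdsGT_zero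
  refine tendsto_order.2 ⟨fun a ha => ?_, fun b hb => ?_⟩
  · obtain ⟨c, hc1, hc2⟩ := exists_between (max_lt ((div_lt_one hC).2 ha) one_pos)
    rw [max_lt_iff, div_lt_iff₀' hC] at hc1
    have := (eventually_laplace_bounds hC hf_nonneg hf_mono hlaplace hc1.2.le hc2).2 a hc1.1
    filter_upwards [hinv.eventually this] with T hT
    rwa [one_div, inv_inv, inv_mul_eq_div] at hT
  · obtain ⟨d, hd1, hd2⟩ := exists_between ((one_lt_div hC).2 hb)
    rw [lt_div_iff₀' hC] at hd2
    have := (eventually_laplace_bounds hC hf_nonneg hf_mono hlaplace zero_le_one hd1).1 b hd2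
    filter_upwards [hinv.eventually this] with T hT
    rwa [one_div, inv_inv, inv_mul_eq_div] at hT
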